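/- Let T ∈ ℝ and let c be a positive Lebesgue measurable function on (T,+∞) such that t ↦ c(t)e^{−t} is decreasing on (T,+∞) and ∫_{T₁}^{+∞} c(s)e^{−s} ds < +∞ for some T₁ > T. Then there exists a positive Lebesgue measurable function c̃ on (T,+∞) satisfying: (1) c̃ ≥ c on (T,+∞); (2) t ↦ c̃(t)e^{−t} is strictly decreasing on (T,+∞), and there is a real number a > T such that c̃ is increasing (monotone nondecreasing) on (a,+∞); (3) ∫_{T₁}^{+∞} c̃(s)e^{−s} ds < +∞. -/

import Mathlib

open MeasureTheory Set Filter
open scoped ENNReal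

/-- The supremum of `c` over `[b, t]`, with value `0` for `t < b`. -/
noncomputable def runningSup (c : ℝ → ℝ) (b t : ℝ) : ℝ := sSup (c '' Icc b t)

section RunningSup

variable {T b : ℝ} {c : ℝ → ℝ}

theorem runningSup_le {t A : ℝ} (hA : 0 ≤ A) (h : ∀ u, b ≤ u → u ≤ t → c u ≤ A) :
    runningSup c b t ≤ A := by
  refine Real.sSup_le ?_ hA
  rintro _ ⟨u, hu, rfl⟩
  exact h u hu.1 hu.2

theorem runningSup_nonneg (hb : T < b) (hpos : ∀ t ∈ Ioi T, 0 < c t) (t : ℝ) :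
    0 ≤ runningSup c b t := by
  refine Real.sSup_nonneg ?_
  rintro _ ⟨u, hu, rfl⟩
  exact (hpos u (hb.trans_le hu.1)).le

/-- Comparison of values of `c` when `t ↦ c t * exp (-t)` is antitone. -/
theorem le_mul_exp_sub_of_antitoneOn (hdec : AntitoneOn (fun t => c t * Real.exp (-t)) (Ioi T))
    {s u : ℝ} (hs : T < s) (hsu : s ≤ u) : c u ≤ c s * Real.exp (u - s) := by
  have h : c u * Real.exp (-u) ≤ c s * Real.exp (-s) := hdec hs (hs.trans_le hsu) hsu
  have h' := mul_le_mul_of_nonneg_right h (Real.exp_pos u).le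
  rw [mul_assoc, mul_assoc, ← Real.exp_add, ← Real.exp_add] at h'
  simpa [sub_eq_neg_add] using h'

theorem le_runningSup (hb : T < b) (hpos : ∀ t ∈ Ioi T, 0 < c t)
    (hdec : AntitoneOn (fun t => c t * Real.exp (-t)) (Ioi T)) {u t : ℝ}
    (hbu : b ≤ u) (hut : u ≤ t) : c u ≤ runningSup c b t := by
  refine le_csSup ⟨c b * Real.exp (t - b), ?_⟩ ⟨u, ⟨hbu, hut⟩, rfl⟩
  rintro _ ⟨v, hv, rfl⟩
  have := hpos b hb
  refine (le_mul_exp_sub_of_antitoneOn hdec hb hv.1).trans ?_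
  gcongr
  exact hv.2

theorem monotone_runningSup (hb : T < b) (hpos : ∀ t ∈ Ioi T, 0 < c t)
    (hdec : AntitoneOn (fun t => c t * Real.exp (-t)) (Ioi T)) : Monotone (runningSup c b) :=
  fun _ t hst => runningSup_le (runningSup_nonneg hb hpos t) fun _ hbu hus =>
    le_runningSup hb hpos hdec hbu (hus.trans hst)

theorem antitoneOn_max_runningSup (hb : T < b) (hpos : ∀ t ∈ Ioi T, 0 < c t)
    (hdec : AntitoneOn (fun t => c t * Real.exp (-t)) (Ioi T)) :
    AntitoneOn (fun t => max (c t) (runningSup c b t) * Real.exp (-t)) (Ioi T) := by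
  intro s hs t ht hst
  have hcs := hpos s hs
  have key : max (c t) (runningSup c b t) ≤
      max (c s) (runningSup c b s) * Real.exp (t - s) := by
    have hm : 0 ≤ max (c s) (runningSup c b s) := hcs.le.trans (le_max_left _ _)
    have hright : ∀ u, s ≤ u → u ≤ t → c u ≤
        max (c s) (runningSup c b s) * Real.exp (t - s) := by
      intro u hsu hut
      refine (le_mul_exp_sub_of_antitoneOn hdec hs hsu).trans ?_
      gcongr
      exact le_max_left _ _
    refine max_le (hright t hst le_rfl) (runningSup_le (by positivity) fun u hbu hut => ?_)
    rcases le_total u s with hus | hsu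
    · refine ((le_runningSup hb hpos hdec hbu hus).trans (le_max_right _ _)).trans
        (le_mul_of_one_le_right hm ?_)
      exact Real.one_le_exp (sub_nonneg.2 hst)
    · exact hright u hsu hut
  calc max (c t) (runningSup c b t) * Real.exp (-t)
      ≤ max (c s) (runningSup c b s) * Real.exp (t - s) * Real.exp (-t) := by gcongr
    _ = max (c s) (runningSup c b s) * Real.exp (-s) := by
      rw [mul_assoc, ← Real.exp_add]
      ring_nf

/-- Splitting `[b, t]` at its midpoint bounds the weighted running supremum. -/
theorem runningSup_mul_exp_neg_le (hb : T < b) (hpos : ∀ t ∈ Ioi T, 0 < c t)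
    (hdec : AntitoneOn (fun t => c t * Real.exp (-t)) (Ioi T)) {t : ℝ} (hbt : b ≤ t) :
    runningSup c b t * Real.exp (-t) ≤
      c ((1 / 2) * t + b / 2) * Real.exp (-((1 / 2) * t + b / 2)) +
        c b * Real.exp (-b / 2) * Real.exp (-(1 / 2) * t) := by
  set m := (1 / 2) * t + b / 2 with hm
  have hbm : b ≤ m := by linarith
  have hcm := hpos m (hb.trans_le hbm)
  have hcb := hpos b hb
  have hle : runningSup c b t ≤ c m * Real.exp (t - m) + c b * Real.exp (m - b) := by
    refine runningSup_le (by positivity) fun u hbu hut => ?_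
    rcases le_total u m with hum | hmu
    · refine le_add_of_nonneg_of_le (by positivity) ?_
      refine (le_mul_exp_sub_of_antitoneOn hdec hb hbu).trans ?_
      gcongr
    · refine le_add_of_le_of_nonneg ?_ (by positivity)
      refine (le_mul_exp_sub_of_antitoneOn hdec (hb.trans_le hbm) hmu).trans ?_
      gcongr
  refine (mul_le_mul_of_nonneg_right hle (Real.exp_pos _).le).trans_eq ?_
  rw [add_mul, mul_assoc, mul_assoc, mul_assoc, ← Real.exp_add, ← Real.exp_add, ← Real.exp_add]
  congr 3
  · ring
  · rw [hm]; ring_nf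

theorem integrableOn_runningSup (hb : T < b) (hpos : ∀ t ∈ Ioi T, 0 < c t)
    (hdec : AntitoneOn (fun t => c t * Real.exp (-t)) (Ioi T))
    (hint : IntegrableOn (fun t => c t * Real.exp (-t)) (Ioi b)) :
    IntegrableOn (fun t => runningSup c b t * Real.exp (-t)) (Ioi b) := by
  have hF := (integrable_indicator_iff measurableSet_Ioi).2 hint
  have hF' := ((hF.comp_add_right (b / 2)).comp_mul_left' (R := 1 / 2) (by norm_num))
  have hE := (exp_neg_integrableOn_Ioi b (b := 1 / 2) (by norm_num)).const_mul
    (c b * Real.exp (-b / 2))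
  refine (hF'.integrableOn.add hE).mono' ?_ ?_
  · exact ((monotone_runningSup hb hpos hdec).measurable.mul (by fun_prop)).aestronglyMeasurable
  · refine (ae_restrict_iff' measurableSet_Ioi).2 (ae_of_all _ fun t (ht : b < t) => ?_)
    have h0 := runningSup_nonneg hb hpos t
    rw [Real.norm_of_nonneg (by positivity)]
    have hmem : (1 / 2) * t + b / 2 ∈ Ioi b := by
      rw [mem_Ioi]; linarith
    simp only [Pi.add_apply, indicator_of_mem hmem]
    exact runningSup_mul_exp_neg_le hb hpos hdec ht.le

end RunningSup

/-- Lemma 2.32 (first part). -/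
theorem stmt_9 (T T₁ : ℝ) (hT₁ : T < T₁) (c : ℝ → ℝ)
    (hc_meas : Measurable c) (hc_pos : ∀ t ∈ Set.Ioi T, 0 < c t)
    (hc_dec : AntitoneOn (fun t => c t * Real.exp (-t)) (Set.Ioi T))
    (hc_int : (∫⁻ s in Set.Ioi T₁, ENNReal.ofReal (c s * Real.exp (-s))) < ⊤) :
    ∃ c' : ℝ → ℝ, Measurable c' ∧ (∀ t ∈ Set.Ioi T, 0 < c' t) ∧
      (∀ t ∈ Set.Ioi T, c t ≤ c' t) ∧
      StrictAntiOn (fun t => c' t * Real.exp (-t)) (Set.Ioi T) ∧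
      (∃ a : ℝ, T < a ∧ MonotoneOn c' (Set.Ioi a)) ∧
      (∫⁻ s in Set.Ioi T₁, ENNReal.ofReal (c' s * Real.exp (-s))) < ⊤ := by
  have hmono := monotone_runningSup hT₁ hc_pos hc_dec
  have hmax : ∀ t ∈ Ioi T₁, max (c t) (runningSup c T₁ t) = runningSup c T₁ t := fun t ht =>
    max_eq_right (le_runningSup hT₁ hc_pos hc_dec (le_of_lt ht) le_rfl)
  have hexp : ∀ t : ℝ, Real.exp (t / 2) * Real.exp (-t) = Real.exp (-(1 / 2) * t) := fun t => by
    rw [← Real.exp_add]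
    ring_nf
  have hle : ∀ t, c t ≤ max (c t) (runningSup c T₁ t) + Real.exp (t / 2) := fun t =>
    (le_max_left _ _).trans (le_add_of_nonneg_right (Real.exp_pos _).le)
  refine ⟨fun t => max (c t) (runningSup c T₁ t) + Real.exp (t / 2),
    (hc_meas.max hmono.measurable).add (by fun_prop),
    fun t ht => (hc_pos t ht).trans_le (hle t), fun t _ => hle t, ?_, ⟨T₁, hT₁, ?_⟩, ?_⟩
  · intro s hs t ht hst
    simp only [add_mul, hexp]
    refine add_lt_add_of_le_of_lt
      (antitoneOn_max_runningSup hT₁ hc_pos hc_dec hs ht hst.le) (Real.exp_lt_exp.2 ?_)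
    linarith
  · intro s hs t ht hst
    simp only [hmax s hs, hmax t ht]
    have := hmono hst
    gcongr
  · have hint : IntegrableOn (fun t => c t * Real.exp (-t)) (Ioi T₁) := by
      refine ⟨(hc_meas.mul (by fun_prop)).aestronglyMeasurable, ?_⟩
      rw [hasFiniteIntegral_iff_ofReal]
      · exact hc_int
      · refine (ae_restrict_iff' measurableSet_Ioi).2 (ae_of_all _ fun t ht => ?_)
        have := hc_pos t (hT₁.trans ht)
        simp only [Pi.zero_apply]
        positivity
    have hsum := (integrableOn_runningSup hT₁ hc_pos hc_dec hint).add
      (exp_neg_integrableOn_Ioi T₁ (b := 1 / 2) (by norm_num))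
    refine lt_of_eq_of_lt (setLIntegral_congr_fun measurableSet_Ioi fun t ht => ?_)
      hsum.lintegral_lt_top
    simp only [hmax t ht, add_mul, hexp, Pi.add_apply]
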